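/- arXiv:1210.2012 — 9 statements merged into one kernel-verified Lean document; each statement's English description precedes it below -/
import Mathlib

section
/- For every t > 0, the difference h(t) = e^{1/t} − ψ'(t) satisfies h(t) > 1; equivalently, ψ'(t) < e^{1/t} − 1 for all t ∈ (0,∞). -/
/-- The trigamma function `ψ'(t) = ∑_{n=0}^∞ 1/(t+n)²`. -/
noncomputable def trigamma (t : ℝ) : ℝ := ∑' n : ℕ, 1 / (t + n) ^ 2

/-- The reciprocal square is dominated by a telescoping difference of the truncated asymptotic
expansion of the trigamma function. -/
lemma one_div_sq_le_trigamma_expansion_sub {x : ℝ} (hx : 0 < x) :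
    1 / x ^ 2 ≤ (1 / x + 1 / (2 * x ^ 2) + 1 / (6 * x ^ 3)) -
      (1 / (x + 1) + 1 / (2 * (x + 1) ^ 2) + 1 / (6 * (x + 1) ^ 3)) := by
  have hdiff : (1 / x + 1 / (2 * x ^ 2) + 1 / (6 * x ^ 3)) -
      (1 / (x + 1) + 1 / (2 * (x + 1) ^ 2) + 1 / (6 * (x + 1) ^ 3)) =
      1 / x ^ 2 + 1 / (6 * x ^ 3 * (x + 1) ^ 3) := by
    field_simp
    ring
  rw [hdiff]
  exact le_add_of_nonneg_right (by positivity)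

lemma trigamma_le {t : ℝ} (ht : 0 < t) :
    trigamma t ≤ 1 / t + 1 / (2 * t ^ 2) + 1 / (6 * t ^ 3) := by
  let f : ℝ → ℝ := fun x ↦ 1 / x + 1 / (2 * x ^ 2) + 1 / (6 * x ^ 3)
  refine Real.tsum_le_of_sum_range_le (fun n ↦ by positivity) fun n ↦ ?_
  calc ∑ i ∈ Finset.range n, 1 / (t + i) ^ 2
      ≤ ∑ i ∈ Finset.range n, (f (t + i) - f (t + (i + 1 : ℕ))) := by
        refine Finset.sum_le_sum fun i _ ↦ ?_
        rw [Nat.cast_succ, ← add_assoc]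
        exact one_div_sq_le_trigamma_expansion_sub (by positivity)
    _ = f t - f (t + n) := by
        rw [Finset.sum_range_sub' (fun i : ℕ ↦ f (t + i))]
        simp
    _ ≤ f t := sub_le_self _ (by positivity)

/-- For every `t > 0`, `e^{1/t} − ψ'(t) > 1`. -/
theorem exp_sub_trigamma_gt_one (t : ℝ) (ht : 0 < t) :
    Real.exp (1 / t) - trigamma t > 1 := by
  have hx : 0 < 1 / t := by positivity
  have hexp := Real.sum_le_exp_of_nonneg hx.le 5
  have hpos : 0 < (1 / t) ^ 4 := by positivity
  have hbound : 1 / t + 1 / (2 * t ^ 2) + 1 / (6 * t ^ 3) =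
      1 / t + (1 / t) ^ 2 / 2 + (1 / t) ^ 3 / 6 := by
    field_simp
  have htri := trigamma_le ht
  rw [hbound] at htri
  norm_num [Finset.sum_range_succ, Nat.factorial, -one_div] at hexp
  linarith
end

section
/- The function h(t) = e^{1/t} − ψ'(t) is completely monotonic on (0,∞), i.e., h has derivatives of all orders on (0,∞) and (−1)^n h^{(n)}(t) ≥ 0 for every integer n ≥ 0 and every t > 0. -/
/-- `f` is completely monotonic on `(0,∞)`: it has derivatives of all orders there
and `(−1)^n f^{(n)}(t) ≥ 0` for all `n ≥ 0` and `t > 0`. -/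
def CompletelyMonotonicOn (f : ℝ → ℝ) : Prop :=
  ContDiffOn ℝ (⊤ : ℕ∞) f (Set.Ioi 0) ∧
    ∀ n : ℕ, ∀ t : ℝ, 0 < t →
      0 ≤ (-1) ^ n * iteratedDerivWithin n f (Set.Ioi 0) t

/-- `f` has a chain of `n` successive derivatives on `(0,∞)` whose signs alternate, starting from
`f ≥ 0`. -/
def AlternatingUpTo : ℕ → (ℝ → ℝ) → Prop
  | 0, f => ∀ t, 0 < t → 0 ≤ f t
  | n + 1, f => (∀ t, 0 < t → 0 ≤ f t) ∧
      ∃ g, AlternatingUpTo n g ∧ ∀ t, 0 < t → HasDerivAt f (-g t) t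

namespace AlternatingUpTo

lemma nonneg {n : ℕ} {f : ℝ → ℝ} (h : AlternatingUpTo n f) {t : ℝ} (ht : 0 < t) : 0 ≤ f t := by
  cases n with
  | zero => exact h t ht
  | succ n => exact h.1 t ht

lemma of_succ {n : ℕ} {f : ℝ → ℝ} (h : AlternatingUpTo (n + 1) f) : AlternatingUpTo n f := by
  induction n generalizing f with
  | zero => exact h.1
  | succ n ih =>
    obtain ⟨h0, g, hg, hd⟩ := h
    exact ⟨h0, g, ih hg, hd⟩

lemma congr {n : ℕ} {f g : ℝ → ℝ} (h : AlternatingUpTo n f) (hfg : ∀ t, 0 < t → f t = g t) :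
    AlternatingUpTo n g := by
  cases n with
  | zero => exact fun t ht => hfg t ht ▸ h t ht
  | succ n =>
    obtain ⟨h0, k, hk, hd⟩ := h
    refine ⟨fun t ht => hfg t ht ▸ h0 t ht, k, hk, fun t ht => ?_⟩
    refine (hd t ht).congr_of_eventuallyEq ?_
    filter_upwards [Ioi_mem_nhds ht] with s hs
    exact (hfg s hs).symm

lemma add {n : ℕ} {f g : ℝ → ℝ} (hf : AlternatingUpTo n f) (hg : AlternatingUpTo n g) :
    AlternatingUpTo n (fun t => f t + g t) := by
  induction n generalizing f g with
  | zero => exact fun t ht => add_nonneg (hf t ht) (hg t ht)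
  | succ n ih =>
    obtain ⟨hf0, f', hf', hfd⟩ := hf
    obtain ⟨hg0, g', hg', hgd⟩ := hg
    refine ⟨fun t ht => add_nonneg (hf0 t ht) (hg0 t ht), _, ih hf' hg', fun t ht => ?_⟩
    exact ((hfd t ht).add (hgd t ht)).congr_deriv (by ring)

lemma mul {n : ℕ} {f g : ℝ → ℝ} (hf : AlternatingUpTo n f) (hg : AlternatingUpTo n g) :
    AlternatingUpTo n (fun t => f t * g t) := by
  induction n generalizing f g with
  | zero => exact fun t ht => mul_nonneg (hf t ht) (hg t ht)
  | succ n ih =>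
    have hfn := hf.of_succ
    have hgn := hg.of_succ
    obtain ⟨hf0, f', hf', hfd⟩ := hf
    obtain ⟨hg0, g', hg', hgd⟩ := hg
    refine ⟨fun t ht => mul_nonneg (hf0 t ht) (hg0 t ht), _,
      (ih hf' hgn).add (ih hfn hg'), fun t ht => ?_⟩
    exact ((hfd t ht).mul (hgd t ht)).congr_deriv (by ring)

lemma const (n : ℕ) {c : ℝ} (hc : 0 ≤ c) : AlternatingUpTo n (fun _ => c) := by
  induction n generalizing c with
  | zero => exact fun _ _ => hc
  | succ n ih =>
    refine ⟨fun _ _ => hc, fun _ => 0, ih le_rfl, fun t _ => ?_⟩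
    simpa using hasDerivAt_const t c

lemma pow {n : ℕ} {f : ℝ → ℝ} (hf : AlternatingUpTo n f) (k : ℕ) :
    AlternatingUpTo n (fun t => f t ^ k) := by
  induction k with
  | zero => simpa using const n zero_le_one
  | succ k ih => simpa only [pow_succ] using ih.mul hf

lemma inv_add (n : ℕ) {a : ℝ} (ha : 0 ≤ a) : AlternatingUpTo n (fun t => (t + a)⁻¹) := by
  induction n with
  | zero => exact fun t ht => by positivity
  | succ n ih =>
    refine ⟨fun t ht => by positivity, _, ih.pow 2, fun t ht => ?_⟩
    have hta : t + a ≠ 0 := by positivity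
    exact (((hasDerivAt_id t).add_const a).inv hta).congr_deriv (by simp [neg_div])

lemma antitoneOn {f g : ℝ → ℝ} (hg : ∀ t, 0 < t → 0 ≤ g t)
    (hd : ∀ t, 0 < t → HasDerivAt f (-g t) t) : AntitoneOn f (Set.Ioi 0) := by
  refine antitoneOn_of_deriv_nonpos (convex_Ioi 0)
    (fun t ht => (hd t ht).continuousAt.continuousWithinAt)
    (fun t ht => ?_) (fun t ht => ?_)
  · rw [interior_Ioi] at ht
    exact (hd t ht).differentiableAt.differentiableWithinAt
  · rw [interior_Ioi] at ht
    rw [(hd t ht).deriv]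
    exact neg_nonpos.2 (hg t ht)

lemma deriv_bound {f g : ℝ → ℝ} (hf : ∀ t, 0 < t → 0 ≤ f t)
    (hg : AntitoneOn g (Set.Ioi 0)) (hd : ∀ t, 0 < t → HasDerivAt f (-g t) t)
    {a : ℝ} (ha : 0 < a) : g a ≤ f (a / 2) * (a / 2)⁻¹ := by
  obtain ⟨c, hc, hc'⟩ := exists_hasDerivAt_eq_slope f (fun t => -g t) (half_lt_self ha)
    (fun t ht => (hd t ((half_pos ha).trans_le ht.1)).continuousAt.continuousWithinAt)
    (fun t ht => hd t ((half_pos ha).trans ht.1))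
  have h1 : g a ≤ g c := hg ((half_pos ha).trans hc.1) ha hc.2.le
  have h2 := hf a ha
  rw [sub_half, eq_div_iff (half_pos ha).ne'] at hc'
  rw [← div_eq_mul_inv, le_div_iff₀ (half_pos ha)]
  nlinarith [mul_le_mul_of_nonneg_right h1 (half_pos ha).le]

/-- A pointwise convergent sum of alternating functions is alternating, with one order lost. -/
lemma tsum {ι : Type*} {n : ℕ} {f : ι → ℝ → ℝ} (hf : ∀ i, AlternatingUpTo (n + 1) (f i))
    (hs : ∀ t, 0 < t → Summable fun i => f i t) :
    AlternatingUpTo n (fun t => ∑' i, f i t) := by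
  induction n generalizing f with
  | zero => exact fun t ht => tsum_nonneg fun i => (hf i).nonneg ht
  | succ n ih =>
    have hf0 : ∀ i t, 0 < t → 0 ≤ f i t := fun i t ht => (hf i).nonneg ht
    choose _ g hg hd using hf
    have hanti : ∀ i, AntitoneOn (g i) (Set.Ioi 0) := fun i => by
      obtain ⟨_, k, hk, hkd⟩ := hg i
      exact antitoneOn (fun t ht => hk.nonneg ht) hkd
    have hbound : ∀ i a, 0 < a → g i a ≤ f i (a / 2) * (a / 2)⁻¹ := fun i a ha =>
      deriv_bound (hf0 i) (hanti i) (hd i) ha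
    have hgs : ∀ t, 0 < t → Summable fun i => g i t := fun t ht =>
      Summable.of_nonneg_of_le (fun i => (hg i).nonneg ht) (fun i => hbound i t ht)
        ((hs _ (half_pos ht)).mul_right _)
    refine ⟨fun t ht => tsum_nonneg fun i => hf0 i t ht, _, ih hg hgs, fun t ht => ?_⟩
    rw [← tsum_neg]
    refine hasDerivAt_tsum_of_isPreconnected (t := Set.Ioi (t / 2)) (y₀ := t)
      (hgs _ (half_pos ht)) isOpen_Ioi isPreconnected_Ioi
      (fun i s hs => hd i s ((half_pos ht).trans hs)) (fun i s hs => ?_)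
      (half_lt_self ht) (hs t ht) (half_lt_self ht)
    have hs0 : 0 < s := (half_pos ht).trans hs
    rw [norm_neg, Real.norm_of_nonneg ((hg i).nonneg hs0)]
    exact hanti i (half_pos ht) hs0 (le_of_lt hs)

lemma contDiffOn {n : ℕ} {f : ℝ → ℝ} (h : AlternatingUpTo (n + 1) f) :
    ContDiffOn ℝ n f (Set.Ioi 0) := by
  induction n generalizing f with
  | zero =>
    obtain ⟨_, g, _, hd⟩ := h
    exact contDiffOn_zero.2 fun t ht => (hd t ht).continuousAt.continuousWithinAt
  | succ n ih =>
    obtain ⟨_, g, hg, hd⟩ := h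
    push_cast
    rw [contDiffOn_succ_iff_deriv_of_isOpen isOpen_Ioi]
    refine ⟨fun t ht => (hd t ht).differentiableAt.differentiableWithinAt, by simp, ?_⟩
    exact (ih hg).neg.congr fun t ht => (hd t ht).deriv

lemma iteratedDerivWithin_nonneg {n : ℕ} {f : ℝ → ℝ} (h : AlternatingUpTo n f) {t : ℝ}
    (ht : 0 < t) : 0 ≤ (-1) ^ n * iteratedDerivWithin n f (Set.Ioi 0) t := by
  induction n generalizing f with
  | zero => simpa using h t ht
  | succ n ih =>
    obtain ⟨_, g, hg, hd⟩ := h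
    have hcongr : Set.EqOn (derivWithin f (Set.Ioi 0)) (-g) (Set.Ioi 0) := fun s hs =>
      (hd s hs).hasDerivWithinAt.derivWithin (isOpen_Ioi.uniqueDiffWithinAt hs)
    rw [iteratedDerivWithin_succ', iteratedDerivWithin_congr hcongr ht,
      iteratedDerivWithin_neg, pow_succ]
    simpa using ih hg

end AlternatingUpTo

lemma completelyMonotonicOn_of_forall_alternatingUpTo {f : ℝ → ℝ}
    (h : ∀ n, AlternatingUpTo n f) : CompletelyMonotonicOn f :=
  ⟨contDiffOn_infty.2 fun n => (h (n + 1)).contDiffOn,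
    fun n _ ht => (h n).iteratedDerivWithin_nonneg ht⟩

lemma summable_trigamma {t : ℝ} (ht : 0 < t) : Summable fun n : ℕ => 1 / (t + n) ^ 2 := by
  refine ((Real.summable_one_div_nat_add_rpow t 2).2 one_lt_two).congr fun n => ?_
  rw [abs_of_pos (by positivity), add_comm, Real.rpow_two]

/-- The remainder of `1/t + 1/(2t²) + 1/(6t³)` over the trigamma function telescopes. -/
lemma hasSum_sub_trigamma {t : ℝ} (ht : 0 < t) :
    HasSum (fun n : ℕ => 1 / 6 * ((t + n)⁻¹ ^ 3 * (t + (n + 1))⁻¹ ^ 3))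
      (t⁻¹ + t⁻¹ ^ 2 / 2 + t⁻¹ ^ 3 / 6 - trigamma t) := by
  rw [hasSum_iff_tendsto_nat_of_nonneg (fun n => by positivity)]
  have hpartial : ∀ N : ℕ,
      ∑ n ∈ Finset.range N, 1 / 6 * ((t + n)⁻¹ ^ 3 * (t + (n + 1))⁻¹ ^ 3) =
        t⁻¹ + t⁻¹ ^ 2 / 2 + t⁻¹ ^ 3 / 6
          - ((t + N)⁻¹ + (t + N)⁻¹ ^ 2 / 2 + (t + N)⁻¹ ^ 3 / 6)
          - ∑ n ∈ Finset.range N, 1 / (t + n) ^ 2 := by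
    intro N
    induction N with
    | zero => simp
    | succ N ih =>
      rw [Finset.sum_range_succ, Finset.sum_range_succ, ih]
      have h1 : t + (N : ℝ) ≠ 0 := by positivity
      have h2 : t + (N : ℝ) + 1 ≠ 0 := by positivity
      push_cast
      rw [← add_assoc]
      generalize t + (N : ℝ) = x at h1 h2
      field_simp
      ring
  simp only [hpartial]
  have hinv : Filter.Tendsto (fun N : ℕ => (t + N)⁻¹) Filter.atTop (nhds 0) :=
    (Filter.tendsto_atTop_add_const_left _ t tendsto_natCast_atTop_atTop).inv_tendsto_atTop
  have hrem := (hinv.add ((hinv.pow 2).div_const 2)).add ((hinv.pow 3).div_const 6)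
  have hlim := (hrem.const_sub (t⁻¹ + t⁻¹ ^ 2 / 2 + t⁻¹ ^ 3 / 6)).sub
    (summable_trigamma ht).hasSum.tendsto_sum_nat
  simpa [trigamma] using hlim

lemma summable_inv_factorial_mul_pow (x : ℝ) :
    Summable fun k : ℕ => ((k + 4).factorial : ℝ)⁻¹ * x ^ (k + 4) := by
  refine ((summable_nat_add_iff 4).2 (Real.summable_pow_div_factorial x)).congr fun k => ?_
  rw [div_eq_inv_mul]

lemma exp_eq_cubic_add_tsum (x : ℝ) :
    Real.exp x = 1 + x + x ^ 2 / 2 + x ^ 3 / 6 +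
      ∑' k : ℕ, ((k + 4).factorial : ℝ)⁻¹ * x ^ (k + 4) := by
  rw [Real.exp_eq_exp_ℝ, NormedSpace.exp_eq_tsum_div]
  beta_reduce
  rw [← (Real.summable_pow_div_factorial x).sum_add_tsum_nat_add 4]
  simp [Finset.sum_range_succ, Nat.factorial, div_eq_inv_mul]

/-- The function `h(t) = e^{1/t} − ψ'(t)` is completely monotonic on `(0,∞)`. -/
theorem completelyMonotonic_exp_sub_trigamma :
    CompletelyMonotonicOn (fun t : ℝ => Real.exp (1 / t) - trigamma t) := by
  refine completelyMonotonicOn_of_forall_alternatingUpTo fun n => ?_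
  have hinv (m : ℕ) : AlternatingUpTo m (fun t => t⁻¹) := by
    simpa using AlternatingUpTo.inv_add m le_rfl
  have hexp : AlternatingUpTo n
      (fun t => ∑' k : ℕ, ((k + 4).factorial : ℝ)⁻¹ * t⁻¹ ^ (k + 4)) :=
    AlternatingUpTo.tsum
      (fun k => (AlternatingUpTo.const _ (by positivity)).mul ((hinv _).pow _))
      fun t _ => summable_inv_factorial_mul_pow t⁻¹
  have htri : AlternatingUpTo n
      (fun t => ∑' k : ℕ, 1 / 6 * ((t + k)⁻¹ ^ 3 * (t + (k + 1))⁻¹ ^ 3)) :=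
    AlternatingUpTo.tsum
      (fun k => (AlternatingUpTo.const _ (by norm_num)).mul
        (((AlternatingUpTo.inv_add _ (by positivity)).pow 3).mul
          ((AlternatingUpTo.inv_add _ (by positivity)).pow 3)))
      fun t ht => (hasSum_sub_trigamma ht).summable
  refine (((AlternatingUpTo.const n zero_le_one).add hexp).add htri).congr fun t ht => ?_
  rw [(hasSum_sub_trigamma ht).tsum_eq, one_div, exp_eq_cubic_add_tsum]
  ring
end

section
/- For every integer i ≥ 0 and every t > 0, the function h(t) = e^{1/t} − ψ'(t) satisfies (−1)^i h^{(i)}(t+1) < (−1)^i h^{(i)}(t), i.e., the i-th derivative of the difference t ↦ h(t+1) − h(t), multiplied by (−1)^i, is strictly negative on (0,∞). -/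
/-- The remainder `exp x - ∑_{n < m} xⁿ / n!` of the exponential series. -/
noncomputable def expTail (m : ℕ) (x : ℝ) : ℝ :=
  Real.exp x - ∑ n ∈ Finset.range m, x ^ n / n.factorial

lemma expTail_nonneg (m : ℕ) {x : ℝ} (hx : 0 ≤ x) : 0 ≤ expTail m x :=
  sub_nonneg.2 (Real.sum_le_exp_of_nonneg hx m)

lemma contDiff_expTail (m : ℕ) (n : WithTop ℕ∞) : ContDiff ℝ n (expTail m) := by
  unfold expTail
  fun_prop

lemma hasDerivAt_expTail (m : ℕ) (x : ℝ) : HasDerivAt (expTail m) (expTail (m - 1) x) x := by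
  unfold expTail
  refine (Real.hasDerivAt_exp x).sub ?_
  cases m with
  | zero => simpa using hasDerivAt_const x (0 : ℝ)
  | succ m =>
    have h : HasDerivAt (fun y : ℝ => ∑ n ∈ Finset.range (m + 1), y ^ n / n.factorial)
        (∑ n ∈ Finset.range (m + 1), (n * x ^ (n - 1)) / n.factorial) x :=
      HasDerivAt.fun_sum fun n _ => (hasDerivAt_pow n x).div_const _
    refine h.congr_deriv ?_
    rw [Finset.sum_range_succ']
    simp only [Nat.cast_zero, zero_mul, zero_div, add_zero, Nat.add_sub_cancel]
    refine Finset.sum_congr rfl fun n _ => ?_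
    rw [Nat.factorial_succ]
    push_cast
    field_simp

lemma contDiffAt_inv_pow_mul_expTail (k m : ℕ) (n : WithTop ℕ∞) {t : ℝ} (ht : 0 < t) :
    ContDiffAt ℝ n (fun s : ℝ => s⁻¹ ^ k * expTail m s⁻¹) t :=
  ((contDiffAt_inv ℝ ht.ne').pow k).mul
    ((contDiff_expTail m n).contDiffAt.comp t (contDiffAt_inv ℝ ht.ne'))

lemma hasDerivAt_inv_pow (k : ℕ) {s : ℝ} (hs : s ≠ 0) :
    HasDerivAt (fun s : ℝ => s⁻¹ ^ k) (-(k * s⁻¹ ^ (k + 1))) s := by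
  refine ((hasDerivAt_inv hs).fun_pow k).congr_deriv ?_
  cases k with
  | zero => simp
  | succ k => simp only [Nat.add_sub_cancel, ← inv_pow]; ring

lemma neg_one_pow_mul_iteratedDeriv_inv_pow_mul_expTail_nonneg (i k m : ℕ) {t : ℝ} (ht : 0 < t) :
    0 ≤ (-1) ^ i * iteratedDeriv i (fun s : ℝ => s⁻¹ ^ k * expTail m s⁻¹) t := by
  induction i generalizing k m with
  | zero =>
    simpa using mul_nonneg (pow_nonneg (inv_nonneg.2 ht.le) k)
      (expTail_nonneg m (inv_nonneg.2 ht.le))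
  | succ i ih =>
    have h : deriv (fun s : ℝ => s⁻¹ ^ k * expTail m s⁻¹) =ᶠ[nhds t] fun s : ℝ =>
        -(k * (s⁻¹ ^ (k + 1) * expTail m s⁻¹) + s⁻¹ ^ (k + 2) * expTail (m - 1) s⁻¹) := by
      filter_upwards [lt_mem_nhds ht] with s hs
      have h := (hasDerivAt_inv_pow k hs.ne').mul
        ((hasDerivAt_expTail m s⁻¹).comp s (hasDerivAt_inv hs.ne'))
      refine (HasDerivAt.deriv h).trans ?_
      simp only [Function.comp_apply, ← inv_pow]
      ring
    have c (k m : ℕ) := contDiffAt_inv_pow_mul_expTail k m i ht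
    rw [iteratedDeriv_succ', h.iteratedDeriv_eq, iteratedDeriv_fun_neg,
      iteratedDeriv_fun_add (contDiffAt_const.mul (c _ _)) (c _ _),
      iteratedDeriv_const_mul_field]
    have := mul_nonneg (Nat.cast_nonneg (α := ℝ) k) (ih (k + 1) m)
    have := ih (k + 2) (m - 1)
    rw [pow_succ]
    linarith

lemma contDiffAt_inv_pow_mul_add_one_inv_pow (a b : ℕ) (n : WithTop ℕ∞) {t : ℝ} (ht : 0 < t) :
    ContDiffAt ℝ n (fun s : ℝ => s⁻¹ ^ a * (s + 1)⁻¹ ^ b) t :=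
  ((contDiffAt_inv ℝ ht.ne').pow a).mul
    (((contDiffAt_id.add contDiffAt_const).inv (by simp; positivity)).pow b)

lemma neg_one_pow_mul_iteratedDeriv_inv_pow_mul_add_one_inv_pow_pos (i a b : ℕ) {t : ℝ}
    (ht : 0 < t) :
    0 < (-1) ^ i * iteratedDeriv i (fun s : ℝ => s⁻¹ ^ (a + 1) * (s + 1)⁻¹ ^ b) t := by
  induction i generalizing a b with
  | zero => simp; positivity
  | succ i ih =>
    have h : deriv (fun s : ℝ => s⁻¹ ^ (a + 1) * (s + 1)⁻¹ ^ b) =ᶠ[nhds t] fun s : ℝ =>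
        -((a + 1) * (s⁻¹ ^ (a + 1 + 1) * (s + 1)⁻¹ ^ b) +
          b * (s⁻¹ ^ (a + 1) * (s + 1)⁻¹ ^ (b + 1))) := by
      filter_upwards [lt_mem_nhds ht] with s hs
      have h := (hasDerivAt_inv_pow (a + 1) hs.ne').mul
        ((hasDerivAt_inv_pow b (by positivity : s + 1 ≠ 0)).comp_add_const s 1)
      refine (HasDerivAt.deriv h).trans ?_
      push_cast
      ring
    have c (a b : ℕ) := contDiffAt_inv_pow_mul_add_one_inv_pow a b i ht
    rw [iteratedDeriv_succ', h.iteratedDeriv_eq, iteratedDeriv_fun_neg,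
      iteratedDeriv_fun_add (contDiffAt_const.mul (c _ _)) (contDiffAt_const.mul (c _ _)),
      iteratedDeriv_const_mul_field, iteratedDeriv_const_mul_field]
    have := mul_pos (Nat.cast_add_one_pos (α := ℝ) a) (ih (a + 1) b)
    have := mul_nonneg (Nat.cast_nonneg (α := ℝ) b) (ih a (b + 1)).le
    rw [pow_succ]
    linarith

lemma antitoneOn_neg_one_pow_mul_iteratedDeriv_expTail_inv (i m : ℕ) :
    AntitoneOn (fun t : ℝ => (-1) ^ i * iteratedDeriv i (fun s : ℝ => expTail m s⁻¹) t)
      (Set.Ioi 0) := by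
  have hd (t : ℝ) (ht : 0 < t) :
      DifferentiableAt ℝ (iteratedDeriv i (fun s : ℝ => expTail m s⁻¹)) t := by
    have h := contDiffAt_inv_pow_mul_expTail 0 m (i + 1 : ℕ) ht
    simp only [pow_zero, one_mul] at h
    rw [← iteratedDerivWithin_univ, ← differentiableWithinAt_univ]
    exact h.contDiffWithinAt.differentiableWithinAt_iteratedDerivWithin
      (by exact_mod_cast i.lt_succ_self) (by simp)
  refine antitoneOn_of_deriv_nonpos (convex_Ioi 0)
    (fun t ht => ((hd t ht).const_mul _).continuousAt.continuousWithinAt)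
    (fun t ht => ?_) (fun t ht => ?_) <;> rw [interior_Ioi] at ht
  · exact ((hd t ht).const_mul _).differentiableWithinAt
  · have h := neg_one_pow_mul_iteratedDeriv_inv_pow_mul_expTail_nonneg (i + 1) 0 m ht
    simp only [pow_zero, one_mul, iteratedDeriv_succ, pow_succ] at h
    rw [deriv_const_mul _ (hd t ht)]
    linarith

lemma summable_one_div_add_nat_sq (t : ℝ) : Summable fun n : ℕ => 1 / (t + n) ^ 2 := by
  have h := (Real.summable_one_div_nat_add_rpow t 2).2 one_lt_two
  simpa [add_comm] using h

lemma trigamma_eq_add (t : ℝ) : trigamma t = 1 / t ^ 2 + trigamma (t + 1) := by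
  rw [trigamma, (summable_one_div_add_nat_sq t).tsum_eq_zero_add, trigamma]
  simp [add_assoc, add_comm (1 : ℝ)]

lemma contDiffAt_trigamma (k : WithTop ℕ∞) {t : ℝ} (ht : 0 < t) : ContDiffAt ℝ k trigamma t := by
  obtain ⟨δ, hδ, hδt⟩ := exists_between ht
  have hU : IsOpen {z : ℂ | δ < z.re} := isOpen_lt continuous_const Complex.continuous_re
  have hre (n : ℕ) (z : ℂ) (hz : δ < z.re) : δ + n ≤ (z + n).re := by simpa using hz.le
  have hne (n : ℕ) (z : ℂ) (hz : δ < z.re) : z + n ≠ 0 := fun h => by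
    have := hre n z hz
    rw [h, Complex.zero_re] at this
    have := n.cast_nonneg (α := ℝ)
    linarith
  have hd : DifferentiableOn ℂ (fun z : ℂ => ∑' n : ℕ, 1 / (z + n) ^ 2) {z : ℂ | δ < z.re} := by
    refine Complex.differentiableOn_tsum_of_summable_norm (summable_one_div_add_nat_sq δ)
      (fun n z hz => ?_) hU fun n z hz => ?_
    · have : DifferentiableAt ℂ (fun z : ℂ => (z + n) ^ 2) z := by fun_prop
      exact ((differentiableAt_const _).div this
        (pow_ne_zero 2 (hne n z hz))).differentiableWithinAt
    · rw [norm_div, norm_one, norm_pow]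
      have := (hre n z hz).trans (Complex.re_le_norm _)
      gcongr
  have h : ContDiffAt ℂ k (fun z : ℂ => ∑' n : ℕ, 1 / (z + n) ^ 2) (t : ℂ) :=
    (hd.analyticAt (hU.mem_nhds (by simpa using hδt))).contDiffAt
  refine h.real_of_complex.congr_of_eventuallyEq (.of_forall fun s => ?_)
  rw [trigamma, ← Complex.ofReal_re (∑' n : ℕ, 1 / (s + n) ^ 2), Complex.ofReal_tsum]
  push_cast
  rfl

lemma exp_one_div_sub_trigamma_eq {s : ℝ} (hs : 0 < s) :
    Real.exp (1 / s) - trigamma s = Real.exp (1 / (s + 1)) - trigamma (s + 1) +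
      (6⁻¹ * (s⁻¹ ^ 3 * (s + 1)⁻¹ ^ 3) + (expTail 4 s⁻¹ - expTail 4 (s + 1)⁻¹)) := by
  rw [trigamma_eq_add s]
  simp only [expTail, Finset.sum_range_succ, Finset.sum_range_zero, Nat.factorial, one_div]
  push_cast
  field_simp
  ring

/-- For every integer `i ≥ 0` and every `t > 0`, the function
`h(t) = e^{1/t} − ψ'(t)` satisfies `(−1)^i h^{(i)}(t+1) < (−1)^i h^{(i)}(t)`. -/
theorem iteratedDeriv_succ_lt (i : ℕ) (t : ℝ) (ht : 0 < t) :
    (-1) ^ i *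
        iteratedDeriv i (fun s : ℝ => Real.exp (1 / s) - trigamma s) (t + 1) <
      (-1) ^ i *
        iteratedDeriv i (fun s : ℝ => Real.exp (1 / s) - trigamma s) t := by
  set h : ℝ → ℝ := fun s => Real.exp (1 / s) - trigamma s
  have hP := contDiffAt_inv_pow_mul_add_one_inv_pow 3 3 i ht
  have hR (s : ℝ) (hs : 0 < s) : ContDiffAt ℝ i (fun s : ℝ => expTail 4 s⁻¹) s := by
    simpa using contDiffAt_inv_pow_mul_expTail 0 4 i hs
  have hh : ContDiffAt ℝ i h (t + 1) := by
    refine ContDiffAt.sub ?_ (contDiffAt_trigamma _ (by positivity))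
    exact (contDiffAt_const.div contDiffAt_id (by simp; positivity)).exp
  have hadd : ContDiffAt ℝ i (fun s : ℝ => s + 1) t := by fun_prop
  have hR1 : ContDiffAt ℝ i (fun s : ℝ => expTail 4 (s + 1)⁻¹) t :=
    (hR (t + 1) (by positivity)).comp (f := fun s : ℝ => s + 1) t hadd
  have hh1 : ContDiffAt ℝ i (fun s => h (s + 1)) t := hh.comp (f := fun s : ℝ => s + 1) t hadd
  have heq : h =ᶠ[nhds t] fun s => h (s + 1) +
      (6⁻¹ * (s⁻¹ ^ 3 * (s + 1)⁻¹ ^ 3) + (expTail 4 s⁻¹ - expTail 4 (s + 1)⁻¹)) := by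
    filter_upwards [lt_mem_nhds ht] with s hs using exp_one_div_sub_trigamma_eq hs
  rw [heq.iteratedDeriv_eq, iteratedDeriv_fun_add hh1
      ((contDiffAt_const.mul hP).add ((hR t ht).sub hR1)),
    iteratedDeriv_fun_add (contDiffAt_const.mul hP) ((hR t ht).sub hR1),
    iteratedDeriv_fun_sub (hR t ht) hR1, iteratedDeriv_const_mul_field,
    iteratedDeriv_comp_add_const i h 1,
    iteratedDeriv_comp_add_const i (fun s : ℝ => expTail 4 s⁻¹) 1]
  have hpos := neg_one_pow_mul_iteratedDeriv_inv_pow_mul_add_one_inv_pow_pos i 2 3 ht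
  have hanti := antitoneOn_neg_one_pow_mul_iteratedDeriv_expTail_inv i 4
    (Set.mem_Ioi.2 ht) (Set.mem_Ioi.2 (by positivity : 0 < t + 1)) (by linarith)
  simp only at hanti
  linarith
end

section
/- For every integer i ≥ 0 and every t > 0, the polynomial f_i(t) = 6(i+1)·t(t+1)·[(t+1)^{i+2} + t^{i+2}] − 12·t²(t+1)²·[(t+1)^{i+1} − t^{i+1}] − (i+1)(i+2)·[(t+1)^{i+3} − t^{i+3}] is strictly negative. -/
/-- A sequence with positive initial term and `t * v n < v (n + 1)` for some `t > 0` is positive. -/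
lemma pos_of_mul_lt_succ {t : ℝ} (ht : 0 < t) (v : ℕ → ℝ) (h0 : 0 < v 0)
    (h : ∀ n, 0 < v (n + 1) - t * v n) (n : ℕ) : 0 < v n := by
  induction n with
  | zero => exact h0
  | succ n ih => linarith [h n, mul_pos ht ih]

/-- For every integer `i ≥ 0` and every `t > 0`, the polynomial
`f_i(t) = 6(i+1)·t(t+1)·[(t+1)^{i+2} + t^{i+2}] − 12·t²(t+1)²·[(t+1)^{i+1} − t^{i+1}]
 − (i+1)(i+2)·[(t+1)^{i+3} − t^{i+3}]` is strictly negative. -/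
theorem f_i_neg (i : ℕ) (t : ℝ) (ht : 0 < t) :
    6 * ((i : ℝ) + 1) * (t * (t + 1)) * ((t + 1) ^ (i + 2) + t ^ (i + 2)) -
        12 * (t ^ 2 * (t + 1) ^ 2) * ((t + 1) ^ (i + 1) - t ^ (i + 1)) -
        ((i : ℝ) + 1) * ((i : ℝ) + 2) * ((t + 1) ^ (i + 3) - t ^ (i + 3)) < 0 := by
  -- The generating function of `-f` is `2 / ((1 - (t + 1) x) ^ 3 * (1 - t x) ^ 3)`,
  -- so three applications of the operator `v ↦ v (n + 1) - t * v n` leave a positive closed form.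
  let f : ℕ → ℝ := fun n =>
    ((n : ℝ) + 1) * ((n : ℝ) + 2) * ((t + 1) ^ (n + 3) - t ^ (n + 3)) +
      12 * (t ^ 2 * (t + 1) ^ 2) * ((t + 1) ^ (n + 1) - t ^ (n + 1)) -
      6 * ((n : ℝ) + 1) * (t * (t + 1)) * ((t + 1) ^ (n + 2) + t ^ (n + 2))
  let d : ℕ → ℝ := fun n => f (n + 1) - t * f n
  let e : ℕ → ℝ := fun n => d (n + 1) - t * d n
  have hf0 : f 0 = 2 := by
    simp only [f]; push_cast; ring
  have hd0 : d 0 = 10 * t + 6 := by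
    simp only [d, f]; push_cast; ring
  have he0 : e 0 = 20 * t ^ 2 + 30 * t + 12 := by
    simp only [e, d, f]; push_cast; ring
  have he : ∀ n, e (n + 1) - t * e n = ((n : ℝ) + 4) * ((n : ℝ) + 5) * (t + 1) ^ (n + 3) := by
    intro n
    simp only [e, d, f, pow_add]
    push_cast
    generalize (t + 1) ^ n = x
    generalize t ^ n = y
    ring
  have he_pos : ∀ n, 0 < e n :=
    pos_of_mul_lt_succ ht e (by rw [he0]; positivity) fun n => by rw [he]; positivity
  have hd_pos : ∀ n, 0 < d n := pos_of_mul_lt_succ ht d (by rw [hd0]; positivity) he_pos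
  have hf_pos : 0 < f i := pos_of_mul_lt_succ ht f (by rw [hf0]; positivity) hd_pos i
  simp only [f] at hf_pos
  linarith
end

section
/- For every integer k ≥ 0, the function t ↦ t^{k+1} H_k(t) is completely monotonic on (0,∞), where H_k(t) = e^{1/t} − ∑_{m=0}^k 1/(m! t^m). -/
/-- `H_k(t) = e^{1/t} − ∑_{m=0}^k 1/(m! t^m)`, the remainder of the
Laurent series expansion of `e^{1/t}`. -/
noncomputable def H (k : ℕ) (t : ℝ) : ℝ :=
  Real.exp (1 / t) - ∑ m ∈ Finset.range (k + 1), 1 / (m.factorial * t ^ m)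

/-- The coefficients of `-F'`, where `F t = ∑ a m * t⁻¹ ^ m`. -/
noncomputable def negDerivCoeff (a : ℕ → ℝ) : ℕ → ℝ
  | 0 => 0
  | m + 1 => m * a m

theorem summable_natCast_mul_of_forall_summable {a : ℕ → ℝ} (ha : ∀ m, 0 ≤ a m)
    (hs : ∀ r : ℝ, 0 < r → Summable fun m => a m * r ^ m) {r : ℝ} (hr : 0 < r) :
    Summable fun m : ℕ => m * a m * r ^ m := by
  refine Summable.of_nonneg_of_le (fun m => by have := ha m; positivity) (fun m => ?_)
    (hs (2 * r) (by positivity))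
  have h2 : (m : ℝ) ≤ 2 ^ m := by exact_mod_cast (Nat.lt_two_pow_self (n := m)).le
  have h := mul_le_mul_of_nonneg_right h2 (mul_nonneg (ha m) (pow_pos hr m).le)
  calc (m : ℝ) * a m * r ^ m = m * (a m * r ^ m) := by ring
    _ ≤ 2 ^ m * (a m * r ^ m) := h
    _ = a m * (2 * r) ^ m := by rw [mul_pow]; ring

theorem negDerivCoeff_nonneg {a : ℕ → ℝ} (ha : ∀ m, 0 ≤ a m) (m : ℕ) :
    0 ≤ negDerivCoeff a m := by
  cases m with
  | zero => exact le_rfl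
  | succ m => exact mul_nonneg m.cast_nonneg (ha m)

theorem summable_negDerivCoeff {a : ℕ → ℝ} (ha : ∀ m, 0 ≤ a m)
    (hs : ∀ r : ℝ, 0 < r → Summable fun m => a m * r ^ m) (r : ℝ) (hr : 0 < r) :
    Summable fun m => negDerivCoeff a m * r ^ m := by
  rw [← summable_nat_add_iff 1]
  refine ((summable_natCast_mul_of_forall_summable ha hs hr).mul_right r).congr fun m => ?_
  simp only [negDerivCoeff, pow_succ]
  ring

theorem hasDerivAt_tsum_mul_inv_pow {a : ℕ → ℝ} (ha : ∀ m, 0 ≤ a m)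
    (hs : ∀ r : ℝ, 0 < r → Summable fun m => a m * r ^ m) {t : ℝ} (ht : 0 < t) :
    HasDerivAt (fun t : ℝ => ∑' m, a m * t⁻¹ ^ m)
      (-∑' m, negDerivCoeff a m * t⁻¹ ^ m) t := by
  have hd : 0 < t / 2 := by positivity
  have hmem : t ∈ Set.Ioi (t / 2) := by simp only [Set.mem_Ioi]; linarith
  have hsum := summable_negDerivCoeff ha hs
  have key := hasDerivAt_tsum_of_isPreconnected
    (g := fun m (y : ℝ) => a m * y⁻¹ ^ m)
    (g' := fun m (y : ℝ) => -(negDerivCoeff a (m + 1) * y⁻¹ ^ (m + 1)))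
    ((summable_nat_add_iff 1).2 (hsum (t / 2)⁻¹ (by positivity)))
    isOpen_Ioi isPreconnected_Ioi ?_ ?_ hmem (hs t⁻¹ (by positivity)) hmem
  · rw [tsum_neg] at key
    rw [(hsum t⁻¹ (by positivity)).tsum_eq_zero_add]
    simpa [negDerivCoeff] using key
  · intro m y hy
    have hy0 : y ≠ 0 := (hd.trans hy).ne'
    refine (((hasDerivAt_inv hy0).fun_pow m).const_mul (a m)).congr_deriv ?_
    cases m with
    | zero => simp [negDerivCoeff]
    | succ m =>
      simp only [negDerivCoeff, Nat.add_sub_cancel, inv_pow]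
      field_simp
      ring
  · intro m y hy
    have hy0 : 0 < y := hd.trans hy
    have hc := negDerivCoeff_nonneg ha (m + 1)
    rw [norm_neg, Real.norm_of_nonneg (by positivity)]
    have hle : y⁻¹ ≤ (t / 2)⁻¹ := inv_anti₀ hd (le_of_lt hy)
    gcongr

theorem neg_one_pow_mul_iteratedDerivWithin_tsum_nonneg (n : ℕ) {a : ℕ → ℝ} (ha : ∀ m, 0 ≤ a m)
    (hs : ∀ r : ℝ, 0 < r → Summable fun m => a m * r ^ m) {t : ℝ} (ht : 0 < t) :
    0 ≤ (-1) ^ n *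
      iteratedDerivWithin n (fun t : ℝ => ∑' m, a m * t⁻¹ ^ m) (Set.Ioi 0) t := by
  induction n generalizing a with
  | zero =>
    simp only [pow_zero, one_mul, iteratedDerivWithin_zero]
    exact tsum_nonneg fun m => mul_nonneg (ha m) (by positivity)
  | succ n ih =>
    have hderiv : Set.EqOn
        (derivWithin (fun t : ℝ => ∑' m, a m * t⁻¹ ^ m) (Set.Ioi 0))
        (fun t : ℝ => -∑' m, negDerivCoeff a m * t⁻¹ ^ m) (Set.Ioi 0) := fun y hy =>
      (hasDerivAt_tsum_mul_inv_pow ha hs hy).hasDerivWithinAt.derivWithin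
        (isOpen_Ioi.uniqueDiffWithinAt hy)
    rw [iteratedDerivWithin_succ', iteratedDerivWithin_congr hderiv ht,
      iteratedDerivWithin_fun_neg, pow_succ]
    simpa using ih (negDerivCoeff_nonneg ha) (summable_negDerivCoeff ha hs)

theorem pow_mul_H_eq_tsum (k : ℕ) {t : ℝ} (ht : 0 < t) :
    t ^ (k + 1) * H k t = ∑' m : ℕ, ((m + (k + 1)).factorial : ℝ)⁻¹ * t⁻¹ ^ m := by
  have hsum := Real.summable_pow_div_factorial t⁻¹
  have hexp : Real.exp (1 / t) = ∑' m : ℕ, t⁻¹ ^ m / m.factorial := by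
    rw [one_div, Real.exp_eq_exp_ℝ, NormedSpace.exp_eq_tsum_div]
  have hfin : ∑ m ∈ Finset.range (k + 1), 1 / ((m.factorial : ℝ) * t ^ m) =
      ∑ m ∈ Finset.range (k + 1), t⁻¹ ^ m / m.factorial :=
    Finset.sum_congr rfl fun m _ => by rw [inv_pow]; field_simp
  rw [H, hexp, hfin, ← hsum.sum_add_tsum_nat_add (k + 1), add_sub_cancel_left, ← tsum_mul_left]
  refine tsum_congr fun m => ?_
  rw [inv_pow, inv_pow, pow_add t m]
  field_simp

theorem contDiffOn_pow_mul_H (k : ℕ) {n : WithTop ℕ∞} :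
    ContDiffOn ℝ n (fun t : ℝ => t ^ (k + 1) * H k t) (Set.Ioi 0) := by
  intro t ht
  have ht0 : t ≠ 0 := (Set.mem_Ioi.1 ht).ne'
  unfold H
  refine ContDiffAt.contDiffWithinAt ?_
  refine (contDiffAt_id.pow _).mul (ContDiffAt.sub ?_ (ContDiffAt.sum fun m _ => ?_))
  · exact (contDiffAt_const.div contDiffAt_id ht0).exp
  · exact contDiffAt_const.div (contDiffAt_const.mul (contDiffAt_id.pow m))
      (mul_ne_zero (by positivity) (pow_ne_zero m ht0))

/-- For every integer `k ≥ 0`, the function `t ↦ t^{k+1} H_k(t)` is completely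
monotonic on `(0,∞)`. -/
theorem completelyMonotonic_pow_mul_H (k : ℕ) :
    CompletelyMonotonicOn (fun t : ℝ => t ^ (k + 1) * H k t) := by
  refine ⟨contDiffOn_pow_mul_H k, fun n t ht => ?_⟩
  have hF : Set.EqOn (fun t : ℝ => t ^ (k + 1) * H k t)
      (fun t => ∑' m : ℕ, ((m + (k + 1)).factorial : ℝ)⁻¹ * t⁻¹ ^ m) (Set.Ioi 0) :=
    fun y hy => pow_mul_H_eq_tsum k hy
  rw [iteratedDerivWithin_congr hF ht]
  refine neg_one_pow_mul_iteratedDerivWithin_tsum_nonneg n (fun m => by positivity)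
    (fun r hr => ?_) ht
  refine Summable.of_nonneg_of_le (fun m => by positivity) (fun m => ?_)
    (Real.summable_pow_div_factorial r)
  rw [div_eq_inv_mul]
  gcongr
  exact Nat.le_add_right m (k + 1)
end

section
/- For every integer k ≥ 0 and every real ε > 0, the function t ↦ t^{k+1+ε} H_k(t) is not completely monotonic on (0,∞), where H_k(t) = e^{1/t} − ∑_{m=0}^k 1/(m! t^m). Consequently, the completely monotonic degree of H_k on (0,∞) equals k+1. -/
open Set Filter Topology MeasureTheory

/-- The moment integral `∫₀¹ (1 - s)^k s^j e^{su} ds`. -/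
noncomputable def expMoment (k j : ℕ) (u : ℝ) : ℝ :=
  ∫ s in (0 : ℝ)..1, (1 - s) ^ k * s ^ j * Real.exp (s * u)

lemma expMoment_nonneg (k j : ℕ) (u : ℝ) : 0 ≤ expMoment k j u := by
  apply intervalIntegral.integral_nonneg zero_le_one
  intro s hs
  have h1 : 0 ≤ 1 - s := by linarith [hs.2]
  have h2 : 0 ≤ s := hs.1
  positivity

lemma hasDerivAt_expMoment (k j : ℕ) (u : ℝ) :
    HasDerivAt (expMoment k j) (expMoment k (j + 1) u) u := by
  refine (intervalIntegral.hasDerivAt_integral_of_dominated_loc_of_deriv_le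
    (F := fun u s : ℝ => (1 - s) ^ k * s ^ j * Real.exp (s * u))
    (F' := fun u s : ℝ => (1 - s) ^ k * s ^ (j + 1) * Real.exp (s * u))
    (bound := fun _ => Real.exp (|u| + 1)) (s := Metric.ball u 1)
    (Metric.ball_mem_nhds u one_pos) ?_ ?_ ?_ ?_ ?_ ?_).2
  · exact Eventually.of_forall fun x => (by fun_prop : Continuous _).aestronglyMeasurable
  · exact (by fun_prop : Continuous _).intervalIntegrable _ _
  · exact (by fun_prop : Continuous _).aestronglyMeasurable
  · refine ae_of_all _ fun s hs x hx => ?_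
    rw [uIoc_of_le zero_le_one] at hs
    have h1 : 0 ≤ 1 - s := by linarith [hs.2]
    have h2 : 0 ≤ s := hs.1.le
    rw [Real.norm_of_nonneg (by positivity)]
    have hx' : |x| ≤ |u| + 1 := by
      rw [Metric.mem_ball, Real.dist_eq] at hx
      linarith [abs_sub_abs_le_abs_sub x u]
    have h3 : s * x ≤ |u| + 1 :=
      calc s * x ≤ s * |x| := mul_le_mul_of_nonneg_left (le_abs_self x) h2
        _ ≤ 1 * |x| := mul_le_mul_of_nonneg_right hs.2 (abs_nonneg x)
        _ ≤ |u| + 1 := by rwa [one_mul]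
    have h4 : (1 - s) ^ k * s ^ (j + 1) ≤ 1 :=
      mul_le_one₀ (pow_le_one₀ h1 (by linarith)) (by positivity) (pow_le_one₀ h2 hs.2)
    calc _ ≤ 1 * Real.exp (s * x) := mul_le_mul_of_nonneg_right h4 (Real.exp_pos _).le
      _ ≤ _ := by rw [one_mul]; exact Real.exp_le_exp.2 h3
  · exact intervalIntegrable_const
  · refine ae_of_all _ fun s _ x _ => ?_
    have h := (((hasDerivAt_id x).const_mul s).exp).const_mul ((1 - s) ^ k * s ^ j)
    refine h.congr_deriv ?_
    simp only [id]
    ring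

lemma contDiff_expMoment (k j : ℕ) : ContDiff ℝ (⊤ : ℕ∞) (expMoment k j) := by
  refine contDiff_infty.2 fun n => ?_
  induction n generalizing j with
  | zero =>
    exact contDiff_zero.2 <| continuous_iff_continuousAt.2 fun u =>
      (hasDerivAt_expMoment k j u).continuousAt
  | succ n ih =>
    have hd : deriv (expMoment k j) = expMoment k (j + 1) :=
      funext fun u => (hasDerivAt_expMoment k j u).deriv
    push_cast
    refine contDiff_succ_iff_deriv.2
      ⟨fun u => (hasDerivAt_expMoment k j u).differentiableAt, by simp, ?_⟩
    rw [hd]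
    exact ih (j + 1)

lemma mul_expMoment_succ (k : ℕ) (u : ℝ) :
    u * expMoment (k + 1) 0 u = (k + 1) * expMoment k 0 u - 1 := by
  have h := intervalIntegral.integral_eq_sub_of_hasDerivAt (a := 0) (b := 1)
    (f := fun s : ℝ => (1 - s) ^ (k + 1) * Real.exp (s * u))
    (f' := fun s : ℝ => u * ((1 - s) ^ (k + 1) * s ^ 0 * Real.exp (s * u))
      - (k + 1) * ((1 - s) ^ k * s ^ 0 * Real.exp (s * u)))
    (fun s _ => by
      have h1 := (((hasDerivAt_id s).const_sub 1).pow (k + 1)).mul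
        (((hasDerivAt_id s).mul_const u).exp)
      refine h1.congr_deriv ?_
      simp
      ring)
    ((by fun_prop : Continuous _).intervalIntegrable _ _)
  rw [intervalIntegral.integral_sub ((by fun_prop : Continuous _).intervalIntegrable _ _)
    ((by fun_prop : Continuous _).intervalIntegrable _ _),
    intervalIntegral.integral_const_mul, intervalIntegral.integral_const_mul] at h
  simp only [expMoment]
  simp at h ⊢
  linarith

lemma pow_mul_expMoment (k : ℕ) (u : ℝ) :
    u ^ (k + 1) * expMoment k 0 u
      = k.factorial * (Real.exp u - ∑ m ∈ Finset.range (k + 1), u ^ m / m.factorial) := by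
  induction k with
  | zero =>
    have h := intervalIntegral.integral_eq_sub_of_hasDerivAt (a := 0) (b := 1)
      (f := fun s : ℝ => Real.exp (s * u)) (f' := fun s : ℝ => u * Real.exp (s * u))
      (fun s _ => by
        refine (((hasDerivAt_id s).mul_const u).exp).congr_deriv ?_
        simp
        ring)
      ((by fun_prop : Continuous _).intervalIntegrable _ _)
    rw [intervalIntegral.integral_const_mul] at h
    simp only [expMoment]
    simp [h]
  | succ k ih =>
    rw [pow_succ, mul_assoc, mul_expMoment_succ, Finset.sum_range_succ, Nat.factorial_succ]
    have hk : (k.factorial : ℝ) ≠ 0 := by positivity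
    have hk' : (k : ℝ) + 1 ≠ 0 := by positivity
    push_cast
    have : u ^ (k + 1) * ((k + 1) * expMoment k 0 u - 1)
        = (k + 1) * (u ^ (k + 1) * expMoment k 0 u) - u ^ (k + 1) := by ring
    rw [this, ih]
    field_simp
    ring

lemma H_eq (k : ℕ) (t : ℝ) :
    H k t = Real.exp t⁻¹ - ∑ m ∈ Finset.range (k + 1), t⁻¹ ^ m / m.factorial := by
  simp [H, div_eq_mul_inv, mul_comm]

lemma rpow_mul_H_eq (k : ℕ) {t : ℝ} (ht : 0 < t) :
    t ^ ((k : ℝ) + 1) * H k t = (k.factorial : ℝ)⁻¹ * expMoment k 0 t⁻¹ := by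
  have h := pow_mul_expMoment k t⁻¹
  have hr : t ^ ((k : ℝ) + 1) = t ^ (k + 1) := by
    rw [← Nat.cast_add_one, Real.rpow_natCast]
  have hk : (k.factorial : ℝ) ≠ 0 := by positivity
  rw [← H_eq, inv_pow] at h
  rw [hr]
  field_simp at h ⊢
  linarith

/-- If `φ 0, φ 1, …` are nonnegative functions, each the derivative of the previous one, then the
derivatives of `t ↦ t⁻¹ ^ m * φ j t⁻¹` on `(0, ∞)` alternate in sign. -/
lemma iteratedDerivWithin_inv_pow_mul_comp_inv_alternating {φ : ℕ → ℝ → ℝ}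
    (hφ : ∀ j u, 0 ≤ φ j u) (hd : ∀ j u, HasDerivAt (φ j) (φ (j + 1) u) u)
    (hs : ∀ j, ContDiff ℝ (⊤ : ℕ∞) (φ j)) (n m j : ℕ) {t : ℝ} (ht : 0 < t) :
    0 ≤ (-1) ^ n * iteratedDerivWithin n (fun t : ℝ => t⁻¹ ^ m * φ j t⁻¹) (Ioi 0) t := by
  have hsm : ∀ m j, ContDiffOn ℝ (⊤ : ℕ∞) (fun t : ℝ => t⁻¹ ^ m * φ j t⁻¹) (Ioi 0) := by
    intro m j
    have hi : ContDiffOn ℝ (⊤ : ℕ∞) (fun t : ℝ => t⁻¹) (Ioi 0) :=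
      contDiffOn_id.inv fun x hx => (mem_Ioi.1 hx).ne'
    exact (hi.pow m).mul ((hs j).comp_contDiffOn hi)
  induction n generalizing m j with
  | zero =>
    have := hφ j t⁻¹
    simp only [pow_zero, one_mul, iteratedDerivWithin_zero]
    positivity
  | succ n ih =>
    have hder : EqOn (derivWithin (fun t : ℝ => t⁻¹ ^ m * φ j t⁻¹) (Ioi 0))
        (-((m : ℝ) • (fun t : ℝ => t⁻¹ ^ (m + 1) * φ j t⁻¹)
          + fun t : ℝ => t⁻¹ ^ (m + 2) * φ (j + 1) t⁻¹)) (Ioi 0) := by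
      intro x hx
      have hx0 : x ≠ 0 := (mem_Ioi.1 hx).ne'
      have h := ((hasDerivAt_inv hx0).pow m).mul ((hd j x⁻¹).comp x (hasDerivAt_inv hx0))
      rw [derivWithin_of_isOpen isOpen_Ioi hx]
      refine h.deriv.trans ?_
      simp only [Pi.neg_apply, Pi.add_apply, Pi.smul_apply, smul_eq_mul, Function.comp,
        Pi.pow_apply]
      cases m with
      | zero => simp [mul_comm]
      | succ m => simp; field_simp; ring
    have hU : UniqueDiffOn ℝ (Ioi (0 : ℝ)) := uniqueDiffOn_Ioi 0
    have hle : ((n : ℕ∞) : WithTop ℕ∞) ≤ ((⊤ : ℕ∞) : WithTop ℕ∞) := by exact_mod_cast le_top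
    have h1 := ((hsm (m + 1) j).of_le hle) t ht
    have h1' : ContDiffWithinAt ℝ n ((m : ℝ) • fun t : ℝ => t⁻¹ ^ (m + 1) * φ j t⁻¹) (Ioi 0) t :=
      h1.const_smul (m : ℝ)
    have h2 := ((hsm (m + 2) (j + 1)).of_le hle) t ht
    rw [iteratedDerivWithin_succ', iteratedDerivWithin_congr hder ht, iteratedDerivWithin_neg,
      iteratedDerivWithin_add (mem_Ioi.2 ht) hU h1' h2,
      iteratedDerivWithin_const_smul (mem_Ioi.2 ht) hU (m : ℝ) h1, smul_eq_mul]
    have i1 := mul_nonneg (Nat.cast_nonneg (α := ℝ) m) (ih (m + 1) j)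
    have i2 := ih (m + 2) (j + 1)
    rw [pow_succ]
    linarith

lemma completelyMonotonicOn_rpow_mul_H (k : ℕ) :
    CompletelyMonotonicOn (fun t : ℝ => t ^ ((k : ℝ) + 1) * H k t) := by
  have heq : EqOn (fun t : ℝ => t ^ ((k : ℝ) + 1) * H k t)
      (fun t => t⁻¹ ^ 0 * ((k.factorial : ℝ)⁻¹ * expMoment k 0 t⁻¹)) (Ioi 0) := fun t ht => by
    simp [rpow_mul_H_eq k ht]
  refine ⟨?_, fun n t ht => ?_⟩
  · refine ContDiffOn.congr ?_ heq
    have hi : ContDiffOn ℝ (⊤ : ℕ∞) (fun t : ℝ => t⁻¹) (Ioi 0) :=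
      contDiffOn_id.inv fun x hx => (mem_Ioi.1 hx).ne'
    simp only [pow_zero, one_mul]
    exact contDiffOn_const.mul ((contDiff_expMoment k 0).comp_contDiffOn hi)
  · rw [iteratedDerivWithin_congr heq ht]
    exact iteratedDerivWithin_inv_pow_mul_comp_inv_alternating
      (φ := fun j u => (k.factorial : ℝ)⁻¹ * expMoment k j u)
      (fun j u => mul_nonneg (by positivity) (expMoment_nonneg k j u))
      (fun j u => (hasDerivAt_expMoment k j u).const_mul _)
      (fun j => contDiff_const.mul (contDiff_expMoment k j)) n 0 0 ht

lemma CompletelyMonotonicOn.antitoneOn {f : ℝ → ℝ} (hf : CompletelyMonotonicOn f) :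
    AntitoneOn f (Ioi 0) := by
  refine antitoneOn_of_deriv_nonpos (convex_Ioi 0) hf.1.continuousOn ?_ ?_
  · rw [interior_Ioi]
    exact hf.1.differentiableOn (by simp)
  · rw [interior_Ioi]
    intro x hx
    have h := hf.2 1 x hx
    rw [iteratedDerivWithin_one, derivWithin_of_isOpen isOpen_Ioi hx] at h
    linarith

lemma inv_factorial_le_rpow_mul_H (k : ℕ) {t : ℝ} (ht : 0 < t) :
    ((k + 1).factorial : ℝ)⁻¹ ≤ t ^ ((k : ℝ) + 1) * H k t := by
  have h := Real.sum_le_exp_of_nonneg (inv_pos.2 ht).le (k + 2)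
  rw [Finset.sum_range_succ] at h
  rw [← Nat.cast_add_one, Real.rpow_natCast]
  calc ((k + 1).factorial : ℝ)⁻¹ = t ^ (k + 1) * (t⁻¹ ^ (k + 1) / (k + 1).factorial) := by
        rw [inv_pow]
        field_simp
    _ ≤ _ := by
        rw [H_eq]
        gcongr
        linarith

lemma not_completelyMonotonicOn_rpow_mul_H (k : ℕ) {ε : ℝ} (hε : 0 < ε) :
    ¬ CompletelyMonotonicOn (fun t : ℝ => t ^ ((k : ℝ) + 1 + ε) * H k t) := by
  intro hf
  have hlim : Tendsto (fun t : ℝ => t ^ ε * ((k + 1).factorial : ℝ)⁻¹) atTop atTop :=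
    (tendsto_rpow_atTop hε).atTop_mul_const (by positivity)
  obtain ⟨t, hlt, ht1⟩ := ((hlim.eventually_gt_atTop
    ((1 : ℝ) ^ ((k : ℝ) + 1 + ε) * H k 1)).and (eventually_ge_atTop 1)).exists
  have ht : 0 < t := by linarith
  have hle : t ^ ((k : ℝ) + 1 + ε) * H k t ≤ (1 : ℝ) ^ ((k : ℝ) + 1 + ε) * H k 1 :=
    hf.antitoneOn (mem_Ioi.2 one_pos) (mem_Ioi.2 ht) ht1
  have hge := mul_le_mul_of_nonneg_left (inv_factorial_le_rpow_mul_H k ht)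
    (Real.rpow_nonneg ht.le ε)
  rw [← mul_assoc, mul_comm (t ^ ε) (t ^ ((k : ℝ) + 1)), ← Real.rpow_add ht] at hge
  linarith

/-- For every integer `k ≥ 0` and every `ε > 0`, the function
`t ↦ t^{k+1+ε} H_k(t)` is not completely monotonic on `(0,∞)`; consequently
(since `t ↦ t^{k+1} H_k(t)` is completely monotonic on `(0,∞)`), the completely
monotonic degree of `H_k` on `(0,∞)` equals `k+1`. -/
theorem not_completelyMonotonic_rpow_mul_H_and_degree (k : ℕ) :
    (∀ ε : ℝ, 0 < ε →
      ¬ CompletelyMonotonicOn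
          (fun t : ℝ => t ^ ((k : ℝ) + 1 + ε) * H k t)) ∧
    CompletelyMonotonicOn (fun t : ℝ => t ^ ((k : ℝ) + 1) * H k t) := by
  exact ⟨fun _ hε => not_completelyMonotonicOn_rpow_mul_H k hε,
    completelyMonotonicOn_rpow_mul_H k⟩
end

section
/- For every integer k ≥ 0 and every real x > 0, H_k(x) = ∫_0^∞ g_k(t) e^{−xt} dt, where g_k(t) = ∑_{m=k+1}^∞ t^{m−1}/(m!·(m−1)!) and H_k(x) = e^{1/x} − ∑_{m=0}^k 1/(m! x^m). (The kernel g_k(t) equals t^k·₁F₂(1; k+1, k+2; t)/(k!(k+1)!).) -/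
open MeasureTheory

/-- The Laplace transform of a monomial: `∫_0^∞ t^n e^{−xt} dt = n!/x^{n+1}`. -/
theorem integral_pow_mul_exp_neg_mul_Ioi (n : ℕ) {x : ℝ} (hx : 0 < x) :
    ∫ t in Set.Ioi (0 : ℝ), t ^ n * Real.exp (-x * t) = n.factorial / x ^ (n + 1) := by
  have h := Real.integral_rpow_mul_exp_neg_mul_Ioi (a := (n : ℝ) + 1) (by positivity) hx
  rw [Real.Gamma_nat_eq_factorial, add_sub_cancel_right] at h
  simp only [Real.rpow_natCast, ← neg_mul] at h
  rw [h, ← Nat.cast_succ, Real.rpow_natCast, one_div, inv_pow, mul_comm, div_eq_mul_inv]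

theorem integrableOn_pow_mul_exp_neg_mul_Ioi (n : ℕ) {x : ℝ} (hx : 0 < x) :
    IntegrableOn (fun t : ℝ => t ^ n * Real.exp (-x * t)) (Set.Ioi 0) := by
  refine .of_integral_ne_zero ?_
  rw [integral_pow_mul_exp_neg_mul_Ioi n hx]
  positivity

theorem hasSum_H (k : ℕ) (x : ℝ) :
    HasSum (fun m : ℕ => 1 / ((m + k + 1).factorial * x ^ (m + k + 1))) (H k x) := by
  have h : HasSum (fun m : ℕ => 1 / (m.factorial * x ^ m)) (Real.exp (1 / x)) := by
    rw [Real.exp_eq_exp_ℝ]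
    convert! NormedSpace.expSeries_div_hasSum_exp (1 / x) using 2 with m
    rw [one_div_pow, div_div, mul_comm]
  exact (hasSum_nat_add_iff' (k + 1)).mpr h

/-- For every integer `k ≥ 0` and every `x > 0`,
`H_k(x) = ∫_0^∞ (∑_{m=k+1}^∞ t^{m−1}/(m!·(m−1)!)) e^{−xt} dt`; the kernel is the
series `∑_{j=0}^∞ t^{j+k}/((j+k+1)!·(j+k)!) = t^k·₁F₂(1;k+1,k+2;t)/(k!(k+1)!)`. -/
theorem H_integral_repr (k : ℕ) (x : ℝ) (hx : 0 < x) :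
    H k x =
      ∫ t in Set.Ioi (0 : ℝ),
        (∑' m : ℕ, t ^ (m + k) / ((m + k + 1).factorial * (m + k).factorial)) *
          Real.exp (-x * t) := by
  set F : ℕ → ℝ → ℝ := fun m t =>
    t ^ (m + k) / ((m + k + 1).factorial * (m + k).factorial) * Real.exp (-x * t) with hF
  have hF_eq (m : ℕ) : F m = fun t => ((m + k + 1).factorial * (m + k).factorial : ℝ)⁻¹ *
      (t ^ (m + k) * Real.exp (-x * t)) := by
    funext t
    simp only [hF]
    ring
  have hF_int (m : ℕ) : IntegrableOn (F m) (Set.Ioi 0) := by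
    rw [hF_eq]
    exact (integrableOn_pow_mul_exp_neg_mul_Ioi (m + k) hx).const_mul _
  have hF_val (m : ℕ) :
      ∫ t in Set.Ioi (0 : ℝ), F m t = 1 / ((m + k + 1).factorial * x ^ (m + k + 1)) := by
    rw [hF_eq, integral_const_mul, integral_pow_mul_exp_neg_mul_Ioi _ hx]
    field_simp
  have hF_norm (m : ℕ) :
      ∫ t in Set.Ioi (0 : ℝ), ‖F m t‖ = 1 / ((m + k + 1).factorial * x ^ (m + k + 1)) := by
    rw [← hF_val]
    refine setIntegral_congr_fun measurableSet_Ioi fun t ht => Real.norm_of_nonneg ?_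
    have : 0 < t := ht
    positivity
  have hsum := hasSum_integral_of_summable_integral_norm hF_int
    ((hasSum_H k x).summable.congr fun m => (hF_norm m).symm)
  simp only [hF_val] at hsum
  rw [(hasSum_H k x).unique hsum]
  simp only [hF, tsum_mul_right]
end

section
/- For every real u > 0, ∑_{m=0}^∞ u^m/(m!·(m+1)!) ≥ u/(1 − e^{−u}). (The left-hand side equals I_1(2√u)/√u, with I_1 the first order modified Bessel function of the first kind.) -/
/-- The `(2, 2)` Padé approximant of `exp` is a lower bound for it on the nonnegative reals. -/
theorem Real.pade_two_two_le_exp {u : ℝ} (hu : 0 ≤ u) :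
    u ^ 2 + 6 * u + 12 ≤ Real.exp u * (u ^ 2 - 6 * u + 12) := by
  have pos (x : ℝ) : 0 < x ^ 2 - 6 * x + 12 := by nlinarith [sq_nonneg (x - 3)]
  have deriv_ratio (x : ℝ) :
      HasDerivAt (fun x : ℝ => Real.exp (-x) * (x ^ 2 + 6 * x + 12) / (x ^ 2 - 6 * x + 12))
        (-(Real.exp (-x) * x ^ 4 / (x ^ 2 - 6 * x + 12) ^ 2)) x := by
    have hexp : HasDerivAt (fun x : ℝ => Real.exp (-x)) (-Real.exp (-x)) x := by
      simpa using (hasDerivAt_neg x).exp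
    have hnum : HasDerivAt (fun x : ℝ => x ^ 2 + 6 * x + 12) (2 * x + 6) x := by
      simpa using ((hasDerivAt_pow 2 x).add ((hasDerivAt_id x).const_mul 6)).add_const 12
    have hden : HasDerivAt (fun x : ℝ => x ^ 2 - 6 * x + 12) (2 * x - 6) x := by
      simpa using ((hasDerivAt_pow 2 x).sub ((hasDerivAt_id x).const_mul 6)).add_const 12
    refine ((hexp.mul hnum).div hden (pos x).ne').congr_deriv ?_
    rw [← neg_div]
    congr 1
    simp only [Pi.mul_apply]
    ring
  have anti := antitone_of_hasDerivAt_nonpos deriv_ratio fun x => neg_nonpos.2 (by positivity)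
  have ratio_le := anti hu
  norm_num at ratio_le
  rw [div_le_one (pos u), Real.exp_neg, inv_mul_le_iff₀ (Real.exp_pos u)] at ratio_le
  exact ratio_le

/-- For every `u > 0`, `∑_{m=0}^∞ u^m/(m!·(m+1)!) ≥ u/(1 − e^{−u})`; the
left-hand side equals `I_1(2√u)/√u` with `I_1` the first order modified Bessel
function of the first kind. -/
theorem tsum_ge_div_one_sub_exp (u : ℝ) (hu : 0 < u) :
    (∑' m : ℕ, u ^ m / (m.factorial * (m + 1).factorial)) ≥
      u / (1 - Real.exp (-u)) := by
  have summable : Summable fun m : ℕ => u ^ m / ((m.factorial : ℝ) * (m + 1).factorial) := by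
    refine (Real.summable_pow_div_factorial u).of_nonneg_of_le (fun m => by positivity) fun m => ?_
    have : (1 : ℝ) ≤ (m + 1).factorial := by exact_mod_cast (m + 1).factorial_pos
    gcongr
    exact le_mul_of_one_le_right (by positivity) this
  have partial_sum_le := summable.sum_le_tsum (Finset.range 3) fun m _ => by positivity
  have exp_lt_one : Real.exp (-u) < 1 := by simpa using hu
  refine le_trans ?_ partial_sum_le
  norm_num [Finset.sum_range_succ, Nat.factorial]
  rw [div_le_iff₀ (sub_pos.2 exp_lt_one)]
  have pade := mul_le_mul_of_nonneg_left (Real.pade_two_two_le_exp hu.le) (Real.exp_pos (-u)).le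
  rw [← mul_assoc, ← Real.exp_add, neg_add_cancel, Real.exp_zero] at pade
  linarith
end

section
/- For every real t > 0, I_1(t) > (t/2)³ / (1 − e^{−(t/2)²}), where I_1(t) = ∑_{k=0}^∞ (t/2)^{2k+1}/(k!·(k+1)!) is the first order modified Bessel function of the first kind. -/
/-- The `[2/2]` Padé bound for the exponential on `[0, ∞)`, cleared of denominators. -/
theorem pade_two_two_le_exp_mul {x : ℝ} (hx : 0 ≤ x) :
    12 + 6 * x + x ^ 2 ≤ Real.exp x * (12 - 6 * x + x ^ 2) := by
  have hexp := Real.sum_le_exp_of_nonneg hx 7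
  have hpos : 0 ≤ 12 - 6 * x + x ^ 2 := by nlinarith [sq_nonneg (x - 3)]
  refine le_trans ?_ (mul_le_mul_of_nonneg_right hexp hpos)
  simp only [Finset.sum_range_succ, Finset.sum_range_zero, Nat.factorial]
  push_cast
  have h : 0 ≤ x ^ 5 / 60 + x ^ 6 / 120 + x ^ 8 / 720 := by positivity
  linear_combination h

/-- The quotient `x / (1 - e⁻ˣ)` is bounded by its second order Taylor polynomial. -/
theorem div_one_sub_exp_neg_le {x : ℝ} (hx : 0 < x) :
    x / (1 - Real.exp (-x)) ≤ 1 + x / 2 + x ^ 2 / 12 := by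
  have hlt : Real.exp (-x) < 1 := Real.exp_lt_one_iff.2 (neg_neg_of_pos hx)
  rw [div_le_iff₀ (sub_pos.2 hlt)]
  have h := mul_le_mul_of_nonneg_left (pade_two_two_le_exp_mul hx.le) (Real.exp_pos (-x)).le
  rw [← mul_assoc, ← Real.exp_add, neg_add_cancel, Real.exp_zero, one_mul] at h
  linear_combination h / 12

theorem summable_besselI_one (u : ℝ) :
    Summable fun k : ℕ => u ^ (2 * k + 1) / ((k.factorial : ℝ) * ((k + 1).factorial : ℝ)) := by
  refine Summable.of_norm_bounded ((Real.summable_pow_div_factorial (u ^ 2)).mul_left |u|)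
    fun k => ?_
  have h1 : (1 : ℝ) ≤ ((k + 1).factorial : ℝ) := by exact_mod_cast Nat.factorial_pos (k + 1)
  have h0 : (0 : ℝ) < (k.factorial : ℝ) := by exact_mod_cast Nat.factorial_pos k
  rw [Real.norm_eq_abs, abs_div, abs_of_pos (by positivity : (0 : ℝ) <
    (k.factorial : ℝ) * ((k + 1).factorial : ℝ)), pow_succ, pow_mul, abs_mul,
    abs_of_nonneg (by positivity : 0 ≤ (u ^ 2) ^ k), ← mul_div_assoc, mul_comm]
  gcongr
  exact le_mul_of_one_le_right h0.le h1

/-- For every `t > 0`, the first order modified Bessel function of the first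
kind `I_1(t) = ∑_{k=0}^∞ (t/2)^{2k+1}/(k!·(k+1)!)` satisfies
`I_1(t) > (t/2)³ / (1 − e^{−(t/2)²})`. -/
theorem besselI_one_gt (t : ℝ) (ht : 0 < t) :
    (∑' k : ℕ, (t / 2) ^ (2 * k + 1) / (k.factorial * (k + 1).factorial)) >
      (t / 2) ^ 3 / (1 - Real.exp (-(t / 2) ^ 2)) := by
  have hu : 0 < t / 2 := half_pos ht
  generalize t / 2 = u at hu ⊢
  have hsum := (summable_besselI_one u).sum_le_tsum (Finset.range 4) fun k _ => by positivity
  refine lt_of_lt_of_le ?_ hsum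
  have hquot := mul_le_mul_of_nonneg_left (div_one_sub_exp_neg_le (pow_pos hu 2)) hu.le
  rw [← mul_div_assoc, ← pow_succ'] at hquot
  refine hquot.trans_lt ?_
  simp only [Finset.sum_range_succ, Finset.sum_range_zero, Nat.factorial]
  push_cast
  have h : 0 < u ^ 7 / 144 := by positivity
  linear_combination h
end
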